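/- Let (V,w) be a weighted graph, let k ≥ 1 be an integer, let 0 < ε ≤ 1/2, and let h be an integer with k/ε ≤ h ≤ |V|. Let H ⊆ V be a set of h vertices such that every vertex of H has weighted degree at least the weighted degree of every vertex of V∖H. Then max over S ⊆ H with |S| = k of δ_w(S) is at least (1 − 4ε) times the max over S ⊆ V with |S| = k of δ_w(S). (Approximate kernel for Max-Cut_k, Theorem 2.1.) -/

import Mathlib

open Finset

/-- The cut value of a set `S`: total weight of pairs with exactly one endpoint in `S`. -/
noncomputable def cutVal {V : Type*} [Fintype V] [DecidableEq V]
    (w : V → V → ℝ) (S : Finset V) : ℝ :=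
  ∑ u ∈ S, ∑ v ∈ Sᶜ, w u v

/-- The weighted degree of a vertex `v`. -/
noncomputable def wdeg {V : Type*} [Fintype V] [DecidableEq V]
    (w : V → V → ℝ) (v : V) : ℝ :=
  ∑ u ∈ Finset.univ.erase v, w u v


lemma mk_select {V : Type*} [DecidableEq V] (g : V → V → ℝ) (hs : ∀ u v, g u v = g v u)
    (h0 : ∀ u v, 0 ≤ g u v) (hd : ∀ v, g v v = 0) (f : V → ℝ) (r : ℕ) (hr : 0 < r) :
    ∀ (m : ℕ), r ≤ m → ∀ B : Finset V, B.card = m →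
      ∃ R ⊆ B, R.card = r ∧
        ((r : ℝ) / m) * ∑ v ∈ B, f v - ((r : ℝ) / m) ^ 2 * ∑ u ∈ B, ∑ v ∈ B, g u v
          ≤ ∑ v ∈ R, f v - ∑ u ∈ R, ∑ v ∈ R, g u v := by
  intro m hm
  induction m, hm using Nat.le_induction with
  | base =>
    intro B hB
    refine ⟨B, Subset.refl _, hB, ?_⟩
    have : (r : ℝ) ≠ 0 := by positivity
    rw [div_self this]; simp
  | succ m hm ih =>
    intro B hB
    have hmpos : (0 : ℝ) < m := by exact_mod_cast lt_of_lt_of_le hr hm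
    set F := ∑ v ∈ B, f v with hF
    set G := ∑ u ∈ B, ∑ v ∈ B, g u v with hG
    have hG0 : 0 ≤ G := sum_nonneg fun _ _ => sum_nonneg fun _ _ => h0 _ _
    have hf : ∀ b ∈ B, ∑ v ∈ B.erase b, f v = F - f b := by
      intro b hb
      rw [hF, ← add_sum_erase B f hb]; ring
    have hg : ∀ b ∈ B, ∑ u ∈ B.erase b, ∑ v ∈ B.erase b, g u v = G - 2 * ∑ v ∈ B, g b v := by
      intro b hb
      have h1 : ∀ u, ∑ v ∈ B.erase b, g u v = ∑ v ∈ B, g u v - g u b := by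
        intro u
        rw [← add_sum_erase B (g u) hb]; ring
      simp_rw [h1]
      rw [sum_sub_distrib, hG, ← add_sum_erase B (fun u => ∑ v ∈ B, g u v) hb,
        ← add_sum_erase B (fun v => g b v) hb]
      have h2 : ∑ x ∈ B.erase b, g x b = ∑ x ∈ B.erase b, g b x :=
        sum_congr rfl fun x _ => hs _ _
      rw [h2, hd b]
      ring
    have hBne : B.Nonempty := by rw [← card_pos]; omega
    set p : ℝ := (r : ℝ) / m with hp
    have key : ∃ b ∈ B, ((r : ℝ) / ((m + 1 : ℕ) : ℝ)) * F - ((r : ℝ) / ((m + 1 : ℕ) : ℝ)) ^ 2 * G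
        ≤ p * (F - f b) - p ^ 2 * (G - 2 * ∑ v ∈ B, g b v) := by
      apply exists_le_of_sum_le hBne
      have e : ∑ b ∈ B, (p * (F - f b) - p ^ 2 * (G - 2 * ∑ v ∈ B, g b v))
          = p * ((m + 1) * F - F) - p ^ 2 * ((m + 1) * G - 2 * G) := by
        rw [sum_sub_distrib, ← mul_sum, ← mul_sum, sum_sub_distrib, sum_sub_distrib, ← mul_sum,
          ← hF, ← hG]
        simp [hB]
      rw [e, sum_const, hB, nsmul_eq_mul]
      push_cast
      have hr' : (r : ℝ) = p * m := by rw [hp]; field_simp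
      rw [hr']
      have e2 : ((m : ℝ) + 1) * (p * m / (m + 1) * F - (p * m / (m + 1)) ^ 2 * G)
          = p * m * F - p ^ 2 * G * (m ^ 2 / (m + 1)) := by field_simp
      rw [e2]
      have h3 : (m : ℝ) - 1 ≤ m ^ 2 / (m + 1) := by
        rw [le_div_iff₀ (by positivity)]; nlinarith
      have h4 := mul_le_mul_of_nonneg_left h3 (mul_nonneg (sq_nonneg p) hG0)
      linarith
    obtain ⟨b, hb, hbk⟩ := key
    obtain ⟨R, hRB, hRc, hR⟩ := ih (B.erase b) (by rw [card_erase_of_mem hb]; omega)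
    refine ⟨R, hRB.trans (erase_subset _ _), hRc, ?_⟩
    rw [hf b hb, hg b hb] at hR
    exact hbk.trans hR

lemma mk_main {V : Type*} [Fintype V] [DecidableEq V]
    (w : V → V → ℝ) (hs : ∀ u v, w u v = w v u) (h0 : ∀ u v, 0 ≤ w u v)
    (hd : ∀ v, w v v = 0)
    (k h : ℕ) (ε : ℝ) (hε0 : 0 < ε) (hε : ε ≤ 1 / 2)
    (hkh : (k : ℝ) ≤ ε * h)
    (H : Finset V) (hHcard : H.card = h)
    (hdeg : ∀ u ∈ H, ∀ v ∉ H, wdeg w v ≤ wdeg w u) (S : Finset V) (hS : S.card = k) :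
    ∃ T ⊆ H, T.card = k ∧ (1 - 4 * ε) * cutVal w S ≤ cutVal w T := by
  let X : Finset V → Finset V → ℝ := fun P Q => ∑ u ∈ P, ∑ v ∈ Q, w u v
  have X0 : ∀ P Q, 0 ≤ X P Q := fun P Q => sum_nonneg fun _ _ => sum_nonneg fun _ _ => h0 _ _
  have Xs : ∀ P Q, X P Q = X Q P := by
    intro P Q
    show ∑ u ∈ P, ∑ v ∈ Q, w u v = ∑ u ∈ Q, ∑ v ∈ P, w u v
    rw [sum_comm]
    exact sum_congr rfl fun _ _ => sum_congr rfl fun _ _ => hs _ _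
  have Xl : ∀ P Q Z, Disjoint P Q → X (P ∪ Q) Z = X P Z + X Q Z := by
    intro P Q Z hPQ
    exact sum_union hPQ
  have Xr : ∀ P Q Z, Disjoint P Q → X Z (P ∪ Q) = X Z P + X Z Q := by
    intro P Q Z hPQ
    rw [Xs, Xl _ _ _ hPQ, Xs P, Xs Q]
  have Xm : ∀ P Q Z, P ⊆ Q → X Z P ≤ X Z Q := by
    intro P Q Z hPQ
    exact sum_le_sum fun u _ => sum_le_sum_of_subset_of_nonneg hPQ fun _ _ _ => h0 _ _
  have Xc : ∀ P Z, X Z univ = X Z P + X Z Pᶜ := by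
    intro P Z
    rw [← Xr _ _ _ disjoint_compl_right, union_compl]
  have hw : ∀ v, wdeg w v = ∑ u, w v u := by
    intro v
    unfold wdeg
    rw [← add_sum_erase univ (fun u => w v u) (mem_univ v), hd, zero_add]
    exact sum_congr rfl fun _ _ => hs _ _
  have hD : ∀ P, ∑ v ∈ P, wdeg w v = X P univ := fun P => sum_congr rfl fun v _ => hw v
  have hcut : ∀ P, cutVal w P = X P Pᶜ := fun P => rfl
  set A := S ∩ H with hA
  set O := S \ H with hO
  set B := H \ S with hB
  have hAO : Disjoint A O := by
    rw [disjoint_left]; intro x; simp only [hA, hO, mem_inter, mem_sdiff]; tauto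
  have hSu : S = A ∪ O := by
    ext x; simp only [hA, hO, mem_union, mem_inter, mem_sdiff]; tauto
  have cS : A.card + O.card = k := by rw [← card_union_of_disjoint hAO, ← hSu, hS]
  have cH : A.card + B.card = h := by
    rw [← hHcard, hA, hB, inter_comm]; exact card_inter_add_card_sdiff H S
  have hkh' : k ≤ h := by
    have : (k : ℝ) ≤ h := by
      have : (0 : ℝ) ≤ h := by positivity
      nlinarith
    exact_mod_cast this
  rcases Nat.eq_zero_or_pos O.card with hz | hpos
  · have hOe : O = ∅ := card_eq_zero.mp hz
    refine ⟨S, ?_, hS, ?_⟩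
    · rw [hO, sdiff_eq_empty_iff_subset] at hOe; exact hOe
    · have := X0 S Sᶜ
      rw [hcut]; nlinarith
  have hrm : O.card ≤ B.card := by omega
  obtain ⟨R, hRB, hRc, hR⟩ := mk_select w hs h0 hd
    (fun v => wdeg w v - 2 * ∑ u ∈ A, w v u) O.card hpos B.card hrm B rfl
  rw [sum_sub_distrib, sum_sub_distrib, ← mul_sum, ← mul_sum, hD, hD] at hR
  change _ * (X B univ - 2 * X B A) - _ * X B B ≤ X R univ - 2 * X R A - X R R at hR
  have hAR : Disjoint A R := by
    rw [disjoint_left]; intro x hx hxR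
    have := hRB hxR
    simp only [hA, hB, mem_inter, mem_sdiff] at hx this; tauto
  refine ⟨A ∪ R, union_subset inter_subset_right (hRB.trans sdiff_subset), ?_, ?_⟩
  · rw [card_union_of_disjoint hAR]; omega
  have hBpos : (0 : ℝ) < B.card := by exact_mod_cast lt_of_lt_of_le hpos hrm
  set p : ℝ := (O.card : ℝ) / B.card with hp
  have hp0 : 0 ≤ p := div_nonneg (Nat.cast_nonneg _) hBpos.le
  have hpe : p ≤ ε := by
    rw [hp, div_le_iff₀ hBpos]
    have c1 : (A.card : ℝ) + O.card = k := by exact_mod_cast cS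
    have c2 : (A.card : ℝ) + B.card = h := by exact_mod_cast cH
    have : (0 : ℝ) ≤ A.card := Nat.cast_nonneg _
    nlinarith
  have hDO : X O univ ≤ p * X B univ := by
    rw [hp, div_mul_eq_mul_div, le_div_iff₀ hBpos, ← hD, ← hD]
    have : ∑ v ∈ O, ∑ u ∈ B, wdeg w v ≤ ∑ v ∈ O, ∑ u ∈ B, wdeg w u := by
      refine sum_le_sum fun v hv => sum_le_sum fun u hu => hdeg u ?_ v ?_
      · exact (mem_sdiff.mp hu).1
      · exact (mem_sdiff.mp hv).2
    simp only [sum_const, nsmul_eq_mul, ← mul_sum] at this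
    linarith
  have hT : cutVal w (A ∪ R) = X A univ + X R univ - X A A - 2 * X R A - X R R := by
    have a := Xc (A ∪ R) (A ∪ R)
    rw [hcut]
    rw [Xl A R univ hAR, Xr A R (A ∪ R) hAR, Xl A R A hAR, Xl A R R hAR, Xs A R] at a
    linarith
  have hAS : X A univ = X A A + X O A + X A Sᶜ := by
    rw [Xc S, Xs O A, ← Xr A O A hAO, ← hSu]
  have hOS : X O univ = X O A + X O O + X O Sᶜ := by
    rw [Xc S, ← Xr A O O hAO, ← hSu]
  have hcS : cutVal w S = X A Sᶜ + X O Sᶜ := by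
    rw [hcut, ← Xl A O _ hAO, ← hSu]
  have hBA : X B A ≤ X A Sᶜ := by
    rw [Xs]; apply Xm; intro x hx; rw [mem_compl]; exact (mem_sdiff.mp hx).2
  have hBB : X B B ≤ X B univ := Xm _ _ _ (subset_univ _)
  rw [hT, hcS]
  have n1 := X0 A Sᶜ
  have n2 := X0 O Sᶜ
  have n3 := X0 O A
  have n4 := X0 O O
  have i1 : p ^ 2 * X B B ≤ p * (p * X B univ) := by
    have := mul_le_mul_of_nonneg_left hBB (sq_nonneg p); linarith
  have i2 : (1 - p) * X O univ ≤ (1 - p) * (p * X B univ) :=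
    mul_le_mul_of_nonneg_left hDO (by linarith)
  have i3 : p * X B A ≤ ε * X A Sᶜ := mul_le_mul hpe hBA (X0 _ _) hε0.le
  have i4 : p * X O Sᶜ ≤ ε * X O Sᶜ := mul_le_mul_of_nonneg_right hpe n2
  have i5 : p * X O A ≤ 1 * X O A := mul_le_mul_of_nonneg_right (by linarith) n3
  have i6 : p * X O O ≤ 1 * X O O := mul_le_mul_of_nonneg_right (by linarith) n4
  have i7 := mul_nonneg hε0.le n1
  have i8 := mul_nonneg hε0.le n2
  rw [hOS] at i2
  nlinarith

/-- Approximate kernel for Max-Cut_k (Theorem 2.1): if `H` consists of `h ≥ k/ε`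
highest-weighted-degree vertices, then the best `k`-subset of `H` has cut value at
least `(1 - 4ε)` times the best `k`-subset of `V`. -/
theorem maxcut_kernel_single {V : Type*} [Fintype V] [DecidableEq V]
    (w : V → V → ℝ) (hsymm : ∀ u v, w u v = w v u) (hnonneg : ∀ u v, 0 ≤ w u v)
    (k h : ℕ) (hk : 1 ≤ k) (ε : ℝ) (hε0 : 0 < ε) (hε : ε ≤ 1 / 2)
    (hkh : (k : ℝ) / ε ≤ h) (hhV : h ≤ Fintype.card V)
    (H : Finset V) (hHcard : H.card = h)
    (hdeg : ∀ u ∈ H, ∀ v ∉ H, wdeg w v ≤ wdeg w u) :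
    ∃ T ⊆ H, T.card = k ∧
      ∀ S : Finset V, S.card = k → (1 - 4 * ε) * cutVal w S ≤ cutVal w T := by
  let w' : V → V → ℝ := fun u v => if u = v then 0 else w u v
  have hc : ∀ S, cutVal w' S = cutVal w S := by
    intro S
    refine sum_congr rfl fun u hu => sum_congr rfl fun v hv => ?_
    have : u ≠ v := by rintro rfl; exact (mem_compl.mp hv) hu
    simp [w', this]
  have hg : ∀ v, wdeg w' v = wdeg w v := by
    intro v
    refine sum_congr rfl fun u hu => ?_
    simp [w', (mem_erase.mp hu).1]
  have hkh2 : (k : ℝ) ≤ ε * h := by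
    rw [div_le_iff₀ hε0] at hkh; linarith
  have hkh3 : k ≤ h := by
    have : (k : ℝ) ≤ h := by
      have : (0 : ℝ) ≤ h := by positivity
      nlinarith
    exact_mod_cast this
  have hne : (H.powersetCard k).Nonempty := powersetCard_nonempty.mpr (by omega)
  obtain ⟨T, hT, hTm⟩ := exists_max_image (H.powersetCard k) (cutVal w) hne
  rw [mem_powersetCard] at hT
  refine ⟨T, hT.1, hT.2, fun S hS => ?_⟩
  obtain ⟨T', hT'H, hT'c, hT'⟩ := mk_main w'
    (by intro u v; simp only [w', hsymm u v, eq_comm])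
    (by intro u v; simp only [w']; split_ifs; exacts [le_rfl, hnonneg u v])
    (by intro v; simp [w']) k h ε hε0 hε hkh2 H hHcard
    (by intro u hu v hv; rw [hg, hg]; exact hdeg u hu v hv) S hS
  rw [hc, hc] at hT'
  exact hT'.trans (hTm T' (mem_powersetCard.mpr ⟨hT'H, hT'c⟩))
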